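/- Let n ≥ 2 and let p_1, …, p_n be points in the Euclidean plane. Define A'(i,j) as the minimum bottleneck of an (i,j)-partial tour. Then for every i with 2 ≤ i ≤ n−1: (a) for every j with 1 ≤ j < i, A'(i+1, j) = max( A'(i, j), dist(p_i, p_{i+1}) ); and (b) A'(i+1, i) = min over 1 ≤ k < i of max( A'(i, k), dist(p_k, p_{i+1}) ). -/

import Mathlib

noncomputable section

/-- Points in the Euclidean plane. -/
abbrev Pt := EuclideanSpace ℝ (Fin 2)

/-- The pairs `(x, x')` of elements of `X` with `x < x'` that are consecutive in `X`,
i.e. no element of `X` lies strictly between them. -/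
def consecPairs (X : Finset ℕ) : Finset (ℕ × ℕ) :=
  (X ×ˢ X).filter fun q => q.1 < q.2 ∧ ∀ y ∈ X, ¬ (q.1 < y ∧ y < q.2)

/-- The chain bottleneck of `X`: the maximum distance between consecutive elements of `X`
(`0` if `X` has at most one element). -/
def chainBot (p : ℕ → Pt) (X : Finset ℕ) : ℝ :=
  (consecPairs X).fold max 0 fun q => dist (p q.1) (p q.2)

/-- `(S, T)` is an `(i,j)`-partial tour: `S ∪ T = {1,…,i}`, `S ∩ T = {1}`,
`max S = i` and `max T = j`. -/
def IsPartialTour (i j : ℕ) (S T : Finset ℕ) : Prop :=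
  S ∪ T = Finset.Icc 1 i ∧ S ∩ T = {1} ∧ S.max = (i : WithBot ℕ) ∧ T.max = (j : WithBot ℕ)

/-- `A' i j`: the minimum bottleneck of an `(i,j)`-partial tour. -/
def tourA' (p : ℕ → Pt) (i j : ℕ) : ℝ :=
  sInf {L : ℝ | ∃ S T : Finset ℕ,
    IsPartialTour i j S T ∧ L = max (chainBot p S) (chainBot p T)}

theorem max_eq_coe_iff' (S : Finset ℕ) (i : ℕ) :
    S.max = (i : WithBot ℕ) ↔ i ∈ S ∧ ∀ x ∈ S, x ≤ i := by
  constructor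
  · intro h
    exact ⟨Finset.mem_of_max h, fun x hx => Finset.le_max_of_eq hx h⟩
  · rintro ⟨h1, h2⟩
    apply le_antisymm
    · exact Finset.max_le fun a ha => WithBot.coe_le_coe.2 (h2 a ha)
    · exact Finset.le_max h1

theorem isPartialTour_iff' (i j : ℕ) (S T : Finset ℕ) :
    IsPartialTour i j S T ↔ (∀ x, (x ∈ S ∨ x ∈ T) ↔ (1 ≤ x ∧ x ≤ i)) ∧
      (∀ x, (x ∈ S ∧ x ∈ T) ↔ x = 1) ∧ (i ∈ S ∧ ∀ x ∈ S, x ≤ i) ∧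
      (j ∈ T ∧ ∀ x ∈ T, x ≤ j) := by
  unfold IsPartialTour
  rw [max_eq_coe_iff', max_eq_coe_iff', Finset.ext_iff, Finset.ext_iff]
  simp only [Finset.mem_union, Finset.mem_inter, Finset.mem_Icc, Finset.mem_singleton]

theorem chainBot_le_iff' (p : ℕ → Pt) (X : Finset ℕ) (c : ℝ) :
    chainBot p X ≤ c ↔ 0 ≤ c ∧ ∀ x ∈ X, ∀ y ∈ X, x < y → (∀ z ∈ X, ¬ (x < z ∧ z < y)) →
      dist (p x) (p y) ≤ c := by
  unfold chainBot consecPairs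
  rw [Finset.fold_max_le]
  simp only [Finset.mem_filter, Finset.mem_product, Prod.forall]
  refine and_congr_right fun _ => ⟨fun h x hx y hy h1 h2 => h x y ⟨⟨hx, hy⟩, h1, h2⟩,
    fun h x y h1 => h x h1.1.1 y h1.1.2 h1.2.1 h1.2.2⟩

theorem chainBot_insert' (p : ℕ → Pt) (X : Finset ℕ) (m w : ℕ) (c : ℝ)
    (hm : m ∈ X) (hX : ∀ x ∈ X, x ≤ m) (hw : m < w) :
    chainBot p (insert w X) ≤ c ↔ chainBot p X ≤ c ∧ dist (p m) (p w) ≤ c := by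
  rw [chainBot_le_iff', chainBot_le_iff']
  simp only [Finset.mem_insert]
  constructor
  · rintro ⟨h0, h⟩
    refine ⟨⟨h0, fun x hx y hy hxy hz => h x (Or.inr hx) y (Or.inr hy) hxy ?_⟩,
      h m (Or.inr hm) w (Or.inl rfl) hw ?_⟩
    · rintro z (rfl | hz')
      · have := hX y hy
        omega
      · exact hz z hz'
    · rintro z (rfl | hz')
      · omega
      · have := hX z hz'
        omega
  · rintro ⟨⟨h0, h⟩, hd⟩
    refine ⟨h0, ?_⟩
    rintro x (rfl | hx) y (rfl | hy) hxy hz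
    · omega
    · have := hX y hy
      omega
    · have h1 := hX x hx
      have h2 := hz m (Or.inr hm)
      have : x = m := by omega
      subst this
      exact hd
    · exact h x hx y hy hxy fun z hz' => hz z (Or.inr hz')

theorem sInf_le_iff_finite' (s : Set ℝ) (hf : s.Finite) (hne : s.Nonempty) (c : ℝ) :
    sInf s ≤ c ↔ ∃ x ∈ s, x ≤ c :=
  ⟨fun h => ⟨sInf s, hne.csInf_mem hf, h⟩,
    fun ⟨_, hx, h⟩ => (csInf_le hf.bddBelow hx).trans h⟩

theorem tourA_le_iff' (p : ℕ → Pt) (i j : ℕ) (hj : 1 ≤ j) (hji : j < i) (c : ℝ) :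
    tourA' p i j ≤ c ↔ ∃ S T : Finset ℕ, IsPartialTour i j S T ∧
      chainBot p S ≤ c ∧ chainBot p T ≤ c := by
  unfold tourA'
  rw [sInf_le_iff_finite']
  · constructor
    · rintro ⟨x, ⟨S, T, h, rfl⟩, hx⟩
      exact ⟨S, T, h, max_le_iff.1 hx⟩
    · rintro ⟨S, T, h, hx⟩
      exact ⟨_, ⟨S, T, h, rfl⟩, max_le_iff.2 hx⟩
  · apply Set.Finite.subset (((Finset.Icc 1 i).powerset ×ˢ (Finset.Icc 1 i).powerset).image
      (fun q => max (chainBot p q.1) (chainBot p q.2))).finite_toSet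
    rintro x ⟨S, T, h, rfl⟩
    simp only [Finset.coe_image, Set.mem_image]
    refine ⟨(S, T), ?_, rfl⟩
    simp only [Finset.mem_coe, Finset.mem_product, Finset.mem_powerset]
    rw [← h.1]
    exact ⟨Finset.subset_union_left, Finset.subset_union_right⟩
  · refine ⟨_, insert 1 (Finset.Icc (j + 1) i), Finset.Icc 1 j, ?_, rfl⟩
    rw [isPartialTour_iff']
    simp only [Finset.mem_insert, Finset.mem_Icc]
    refine ⟨fun x => ?_, fun x => ?_, ⟨?_, fun x => ?_⟩, ?_, fun x => ?_⟩ <;> omega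

theorem stmt_4 (n : ℕ) (hn : 2 ≤ n) (p : ℕ → Pt) (i : ℕ) (hi2 : 2 ≤ i) (hi : i ≤ n - 1) :
    (∀ j, 1 ≤ j → j < i →
        tourA' p (i + 1) j = max (tourA' p i j) (dist (p i) (p (i + 1)))) ∧
    tourA' p (i + 1) i =
      sInf {x : ℝ | ∃ k, 1 ≤ k ∧ k < i ∧
        x = max (tourA' p i k) (dist (p k) (p (i + 1)))} := by
  constructor
  · intro j hj hji
    apply eq_of_forall_ge_iff
    intro c
    rw [max_le_iff, tourA_le_iff' p (i + 1) j hj (by omega), tourA_le_iff' p i j hj hji]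
    constructor
    · rintro ⟨S, T, h, hS, hT⟩
      rw [isPartialTour_iff'] at h
      obtain ⟨h1, h2, ⟨h3, h4⟩, h5, h6⟩ := h
      have hiS : i ∈ S := by grind
      rw [← Finset.insert_erase h3, chainBot_insert' p _ i (i + 1) c (by grind) (by grind)
        (by omega)] at hS
      refine ⟨⟨S.erase (i + 1), T, ?_, hS.1, hT⟩, hS.2⟩
      rw [isPartialTour_iff']
      refine ⟨fun x => ?_, fun x => ?_, ⟨?_, fun x => ?_⟩, ?_, fun x => ?_⟩ <;> grind
    · rintro ⟨⟨S, T, h, hS, hT⟩, hd⟩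
      rw [isPartialTour_iff'] at h
      obtain ⟨h1, h2, ⟨h3, h4⟩, h5, h6⟩ := h
      refine ⟨insert (i + 1) S, T, ?_,
        (chainBot_insert' p S i (i + 1) c h3 h4 (by omega)).2 ⟨hS, hd⟩, hT⟩
      rw [isPartialTour_iff']
      refine ⟨fun x => ?_, fun x => ?_, ⟨?_, fun x => ?_⟩, ?_, fun x => ?_⟩ <;> grind
  · apply eq_of_forall_ge_iff
    intro c
    rw [tourA_le_iff' p (i + 1) i (by omega) (by omega), sInf_le_iff_finite']
    · constructor
      · rintro ⟨S, T, h, hS, hT⟩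
        rw [isPartialTour_iff'] at h
        obtain ⟨h1, h2, ⟨h3, h4⟩, h5, h6⟩ := h
        have hne : (S.erase (i + 1)).Nonempty := ⟨1, by grind⟩
        obtain ⟨k, hk⟩ := Finset.max_of_nonempty hne
        replace hk := (max_eq_coe_iff' _ k).1 hk
        obtain ⟨hk1, hk2⟩ := hk
        have hki : k < i := by grind
        have hk0 : 1 ≤ k := by grind
        rw [← Finset.insert_erase h3, chainBot_insert' p _ k (i + 1) c hk1 hk2
          (by omega)] at hS
        refine ⟨_, ⟨k, hk0, hki, rfl⟩, max_le ?_ hS.2⟩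
        rw [tourA_le_iff' p i k hk0 hki]
        refine ⟨T, S.erase (i + 1), ?_, hT, hS.1⟩
        rw [isPartialTour_iff']
        refine ⟨fun x => ?_, fun x => ?_, ⟨?_, fun x => ?_⟩, ?_, fun x => ?_⟩ <;> grind
      · rintro ⟨x, ⟨k, hk0, hki, rfl⟩, hx⟩
        rw [max_le_iff, tourA_le_iff' p i k hk0 hki] at hx
        obtain ⟨⟨S, T, h, hS, hT⟩, hd⟩ := hx
        rw [isPartialTour_iff'] at h
        obtain ⟨h1, h2, ⟨h3, h4⟩, h5, h6⟩ := h
        refine ⟨insert (i + 1) T, S, ?_,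
          (chainBot_insert' p T k (i + 1) c h5 h6 (by omega)).2 ⟨hT, hd⟩, hS⟩
        rw [isPartialTour_iff']
        refine ⟨fun x => ?_, fun x => ?_, ⟨?_, fun x => ?_⟩, ?_, fun x => ?_⟩ <;> grind
    · apply Set.Finite.subset ((Finset.range i).image
        (fun k => max (tourA' p i k) (dist (p k) (p (i + 1))))).finite_toSet
      rintro x ⟨k, _, hk, rfl⟩
      simp only [Finset.coe_image, Set.mem_image]
      exact ⟨k, by simpa using hk, rfl⟩
    · exact ⟨_, 1, le_refl _, by omega, rfl⟩
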